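/- arXiv:2309.16384 — 2 statements merged into one kernel-verified Lean document; each statement's English description precedes it below -/
import Mathlib

section
/- Let P be a finite set of points in EuclideanSpace ℝ (Fin d), let O and C be finite nonempty sets of points, let f : P → E be an assignment with f(p) ∈ O for all p ∈ P such that for every o ∈ O whose fiber P_o := {p ∈ P : f(p) = o} is nonempty one has o = μ(P_o), and let g : E → E satisfy g(x) ∈ C and ‖x − g(x)‖ ≤ ‖x − c‖ for every x ∈ E and every c ∈ C (a nearest-point map onto C). Set OPT := Σ_{p ∈ P} ‖p − f(p)‖² and ALG := Σ_{p ∈ P} ‖p − g(p)‖². Then Σ_{p ∈ P} (‖p − g(f(p))‖² − ‖p − g(p)‖²) ≤ 2·OPT + 2·√(ALG) · √(OPT). -/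
open Finset

/-- `mu Q` is the centroid (mean) of the finite set `Q`. -/
noncomputable def mu {d : ℕ} (Q : Finset (EuclideanSpace ℝ (Fin d))) :
    EuclideanSpace ℝ (Fin d) := (Q.card : ℝ)⁻¹ • ∑ q ∈ Q, q

theorem sum_sub_mu {d : ℕ} (Q : Finset (EuclideanSpace ℝ (Fin d))) :
    ∑ q ∈ Q, (q - mu Q) = 0 := by
  rcases Q.eq_empty_or_nonempty with rfl | hQ
  · simp
  · have hcard : (Q.card : ℝ) ≠ 0 := by exact_mod_cast hQ.card_pos.ne'
    rw [sum_sub_distrib, sum_const, mu, ← Nat.cast_smul_eq_nsmul ℝ, smul_inv_smul₀ hcard, sub_self]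

/-- If every used center is the centroid of its fiber, the residuals `p - f p` are orthogonal in
total to any vector field that depends only on the center. -/
theorem sum_inner_sub_center_eq_zero {d : ℕ} [DecidableEq (EuclideanSpace ℝ (Fin d))]
    {P O : Finset (EuclideanSpace ℝ (Fin d))}
    {f : EuclideanSpace ℝ (Fin d) → EuclideanSpace ℝ (Fin d)}
    (hfO : ∀ p ∈ P, f p ∈ O)
    (hfmean : ∀ o ∈ O, (P.filter (fun p => f p = o)).Nonempty →
      o = mu (P.filter (fun p => f p = o)))
    (h : EuclideanSpace ℝ (Fin d) → EuclideanSpace ℝ (Fin d)) :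
    ∑ p ∈ P, inner ℝ (p - f p) (h (f p)) = 0 := by
  rw [← sum_fiberwise_of_maps_to hfO]
  refine sum_eq_zero fun o ho => ?_
  have hfiber : ∑ p ∈ P with f p = o, inner ℝ (p - f p) (h (f p)) =
      inner ℝ (∑ p ∈ P with f p = o, (p - o)) (h o) := by
    rw [sum_inner]
    refine sum_congr rfl fun p hp => ?_
    rw [(mem_filter.mp hp).2]
  rw [hfiber]
  rcases (P.filter (fun p => f p = o)).eq_empty_or_nonempty with hempty | hne
  · simp [hempty]
  · have hsum := sum_sub_mu (P.filter (fun p => f p = o))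
    rw [← hfmean o ho hne] at hsum
    rw [hsum, inner_zero_left]

/-- Lemma 3.6 (unweighted essence, reassignment cost increase): if `f` assigns every point of `P` to an optimal
center in `O` (each optimal center being the centroid of its fiber) and `g` is a
nearest-point map onto the current centers `C`, then
`Σ_{p ∈ P} (‖p − g(f(p))‖² − ‖p − g(p)‖²) ≤ 2·OPT + 2·√ALG·√OPT`. -/
theorem reassignment_cost_increase {d : ℕ}
    [DecidableEq (EuclideanSpace ℝ (Fin d))]
    (P O C : Finset (EuclideanSpace ℝ (Fin d))) (hO : O.Nonempty) (hC : C.Nonempty)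
    (f : EuclideanSpace ℝ (Fin d) → EuclideanSpace ℝ (Fin d))
    (hfO : ∀ p ∈ P, f p ∈ O)
    (hfmean : ∀ o ∈ O, (P.filter (fun p => f p = o)).Nonempty →
      o = mu (P.filter (fun p => f p = o)))
    (g : EuclideanSpace ℝ (Fin d) → EuclideanSpace ℝ (Fin d))
    (hgC : ∀ x, g x ∈ C)
    (hgmin : ∀ x, ∀ c ∈ C, ‖x - g x‖ ≤ ‖x - c‖)
    (OPT ALG : ℝ)
    (hOPT : OPT = ∑ p ∈ P, ‖p - f p‖ ^ 2)
    (hALG : ALG = ∑ p ∈ P, ‖p - g p‖ ^ 2) :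
    ∑ p ∈ P, (‖p - g (f p)‖ ^ 2 - ‖p - g p‖ ^ 2) ≤
      2 * OPT + 2 * Real.sqrt ALG * Real.sqrt OPT := by
  have hpoint : ∀ p ∈ P, ‖p - g (f p)‖ ^ 2 - ‖p - g p‖ ^ 2 ≤
      2 * ‖p - f p‖ ^ 2 + 2 * (‖p - g p‖ * ‖p - f p‖) +
        2 * inner ℝ (p - f p) (f p - g (f p)) := by
    intro p _
    have hexpand := norm_add_sq_real (p - f p) (f p - g (f p))
    rw [sub_add_sub_cancel] at hexpand
    have hle : ‖f p - g (f p)‖ ≤ ‖p - f p‖ + ‖p - g p‖ := by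
      have htri := norm_sub_le_norm_sub_add_norm_sub (f p) p (g p)
      rw [norm_sub_rev (f p) p] at htri
      exact (hgmin (f p) (g p) (hgC p)).trans htri
    have hsq := pow_le_pow_left₀ (norm_nonneg _) hle 2
    linarith [add_sq ‖p - f p‖ ‖p - g p‖]
  have hcross := sum_inner_sub_center_eq_zero hfO hfmean (fun x => x - g x)
  have hcs := Real.sum_mul_le_sqrt_mul_sqrt P (fun p => ‖p - g p‖) (fun p => ‖p - f p‖)
  have htotal := sum_le_sum hpoint
  rw [sum_add_distrib, sum_add_distrib, ← mul_sum, ← mul_sum, ← mul_sum, hcross, ← hOPT] at htotal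
  rw [← hOPT, ← hALG] at hcs
  linarith
end

section
/- Let δ ∈ (0, 1] and t ≥ 0 be reals. Let P be a finite set of points in EuclideanSpace ℝ (Fin d), let C be a finite set of points and Out ⊆ C with C \ Out nonempty. Let O₁, …, O_s be pairwise disjoint finite nonempty subsets of P, set o_i := μ(O_i), and let q₁, …, q_s be points with ‖q_i − o_i‖ ≤ (1 + δ) · ρ(O_i) for each i. Write O_In := O₁ ∪ ⋯ ∪ O_s, Q := {q₁, …, q_s}, and reassign := cost(P \ O_In, C \ Out) − cost(P \ O_In, C). If cost(P, (C \ Out) ∪ Q) > cost(P, C) − t, then cost(O_In, C) ≤ (1 + (1 + δ)²) · Σ_{i=1}^{s} cost(O_i, o_i) + reassign + t. -/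
open Finset

/-- `cost Q c = ∑_{q ∈ Q} ‖q - c‖²` -/
noncomputable def cost {d : ℕ} (Q : Finset (EuclideanSpace ℝ (Fin d)))
    (c : EuclideanSpace ℝ (Fin d)) : ℝ := ∑ q ∈ Q, ‖q - c‖ ^ 2

/-- `costS Q C = ∑_{q ∈ Q} min_{c ∈ C} ‖q - c‖²` (for nonempty `C`). -/
noncomputable def costS {d : ℕ} (Q C : Finset (EuclideanSpace ℝ (Fin d))) : ℝ :=
  ∑ q ∈ Q, sInf ((fun c => ‖q - c‖ ^ 2) '' (C : Set (EuclideanSpace ℝ (Fin d))))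

lemma costS_summand_le {d : ℕ} {C : Finset (EuclideanSpace ℝ (Fin d))}
    {c : EuclideanSpace ℝ (Fin d)} (hc : c ∈ C) (x : EuclideanSpace ℝ (Fin d)) :
    sInf ((fun c => ‖x - c‖ ^ 2) '' (C : Set (EuclideanSpace ℝ (Fin d)))) ≤ ‖x - c‖ ^ 2 :=
  csInf_le (C.finite_toSet.image _).bddBelow (Set.mem_image_of_mem _ hc)

lemma costS_le_cost {d : ℕ} (Q : Finset (EuclideanSpace ℝ (Fin d)))
    {C : Finset (EuclideanSpace ℝ (Fin d))} {c : EuclideanSpace ℝ (Fin d)} (hc : c ∈ C) :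
    costS Q C ≤ cost Q c :=
  sum_le_sum fun x _ => costS_summand_le hc x

lemma costS_anti {d : ℕ} (Q : Finset (EuclideanSpace ℝ (Fin d)))
    {A B : Finset (EuclideanSpace ℝ (Fin d))} (hA : A.Nonempty) (hAB : A ⊆ B) :
    costS Q B ≤ costS Q A :=
  sum_le_sum fun _ _ => csInf_le_csInf (B.finite_toSet.image _).bddBelow
    ((coe_nonempty.2 hA).image _) (Set.image_mono (coe_subset.2 hAB))

/-- The parallel axis identity for the sum of squared distances. -/
lemma cost_eq_cost_mu_add {d : ℕ} {Q : Finset (EuclideanSpace ℝ (Fin d))} (hQ : Q.Nonempty)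
    (c : EuclideanSpace ℝ (Fin d)) :
    cost Q c = cost Q (mu Q) + Q.card * ‖c - mu Q‖ ^ 2 := by
  have hcard : (Q.card : ℝ) ≠ 0 := Nat.cast_ne_zero.2 hQ.card_ne_zero
  have hsum : ∑ x ∈ Q, (x - mu Q) = 0 := by
    rw [sum_sub_distrib, sum_const, ← Nat.cast_smul_eq_nsmul ℝ, mu, smul_inv_smul₀ hcard,
      sub_self]
  have hinner : ∑ x ∈ Q, inner ℝ (x - mu Q) (c - mu Q) = 0 := by
    rw [← sum_inner, hsum, inner_zero_left]
  have hterm (x : EuclideanSpace ℝ (Fin d)) : ‖x - c‖ ^ 2 =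
      ‖x - mu Q‖ ^ 2 - 2 * inner ℝ (x - mu Q) (c - mu Q) + ‖c - mu Q‖ ^ 2 := by
    rw [← norm_sub_sq_real, sub_sub_sub_cancel_right]
  simp only [cost, hterm, sum_add_distrib, sum_sub_distrib, ← mul_sum, hinner, sum_const,
    nsmul_eq_mul]
  ring

lemma cost_le_of_norm_sub_mu_le {d : ℕ} {Q : Finset (EuclideanSpace ℝ (Fin d))}
    (hQ : Q.Nonempty) {c : EuclideanSpace ℝ (Fin d)} {r a : ℝ}
    (hr : r ^ 2 * (Q.card : ℝ) = cost Q (mu Q)) (hc : ‖c - mu Q‖ ≤ a * r) :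
    cost Q c ≤ (1 + a ^ 2) * cost Q (mu Q) := by
  have h : (Q.card : ℝ) * ‖c - mu Q‖ ^ 2 ≤ Q.card * (a * r) ^ 2 := by gcongr
  rw [cost_eq_cost_mu_add hQ, ← hr]
  linarith

/-- Lemma 3.7 (bad swap inequality) with explicit constants: if swapping out `Out ⊆ C` and
swapping in one δ-core point `qᵢ` per cluster `Oᵢ` fails to decrease the total cost by at
least `t`, then
`cost(O_In, C) ≤ (1 + (1+δ)²)·Σᵢ cost(Oᵢ, μ(Oᵢ)) + reassign + t`, where
`reassign = cost(P \ O_In, C \ Out) − cost(P \ O_In, C)`. -/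
theorem bad_swap_inequality {d s : ℕ} [DecidableEq (EuclideanSpace ℝ (Fin d))]
    (hs : 0 < s) (δ t : ℝ) (hδ0 : 0 < δ) (hδ1 : δ ≤ 1) (ht : 0 ≤ t)
    (P C Out : Finset (EuclideanSpace ℝ (Fin d)))
    (hOut : Out ⊆ C) (hCOut : (C \ Out).Nonempty)
    (O : Fin s → Finset (EuclideanSpace ℝ (Fin d)))
    (hOP : ∀ i, O i ⊆ P) (hOne : ∀ i, (O i).Nonempty)
    (hdisj : ∀ i j, i ≠ j → Disjoint (O i) (O j))
    (ρ : Fin s → ℝ) (hρ0 : ∀ i, 0 ≤ ρ i)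
    (hρ : ∀ i, (ρ i) ^ 2 * ((O i).card : ℝ) = cost (O i) (mu (O i)))
    (q : Fin s → EuclideanSpace ℝ (Fin d))
    (hq : ∀ i, ‖q i - mu (O i)‖ ≤ (1 + δ) * ρ i)
    (hnotimp : costS P ((C \ Out) ∪ Finset.univ.image q) > costS P C - t) :
    costS (Finset.univ.biUnion O) C ≤
      (1 + (1 + δ) ^ 2) * (∑ i, cost (O i) (mu (O i))) +
        (costS (P \ Finset.univ.biUnion O) (C \ Out) -
          costS (P \ Finset.univ.biUnion O) C) + t := by
  set U := Finset.univ.biUnion O with hU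
  have hUP : U ⊆ P := biUnion_subset.2 fun i _ => hOP i
  have hsplit (D : Finset (EuclideanSpace ℝ (Fin d))) :
      costS (P \ U) D + costS U D = costS P D := sum_sdiff hUP
  have hout := costS_anti (P \ U) hCOut
    (subset_union_left (s₁ := C \ Out) (s₂ := Finset.univ.image q))
  have hin : costS U ((C \ Out) ∪ Finset.univ.image q) ≤
      (1 + (1 + δ) ^ 2) * ∑ i, cost (O i) (mu (O i)) := by
    rw [costS, hU, sum_biUnion fun i _ j _ hij => hdisj i j hij, mul_sum]
    exact sum_le_sum fun i _ => (costS_le_cost (O i)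
      (mem_union_right _ (mem_image_of_mem q (mem_univ i)))).trans
        (cost_le_of_norm_sub_mu_le (hOne i) (hρ i) (hq i))
  linarith [hsplit C, hsplit ((C \ Out) ∪ Finset.univ.image q)]
end
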